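/- Let n ≥ 2 and let α₁, …, αₙ be real numbers with −1 < α₁ ≤ α₂ ≤ ⋯ ≤ αₙ, α = α₁ + ⋯ + αₙ, and A = maxᵢ |αᵢ|. Define φ : ℝⁿ → ℝⁿ by φ(x)ᵢ = xᵢ |x|^{αᵢ} for x ≠ 0 and φ(0) = 0, and let p ≥ 1 be a real number with α₁ p ≥ α. Then φ is p-quasiconformal on the punctured unit ball: for every x with 0 < |x| ≤ 1, ‖Dφ(x)‖^p / det Dφ(x) ≤ (1 + A)^p / (1 + α₁). -/

import Mathlib

/-- The generalized radial stretch mapping `φ(x)ᵢ = xᵢ |x|^{αᵢ}` (with `φ(0) = 0`). -/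
noncomputable def radialStretch (n : ℕ) (α : Fin n → ℝ) :
    EuclideanSpace ℝ (Fin n) → EuclideanSpace ℝ (Fin n) := fun x =>
  (WithLp.equiv 2 (Fin n → ℝ)).symm fun i => x i * ‖x‖ ^ α i

open Matrix in
/-- The Jacobian matrix of `radialStretch n α` at `x ≠ 0`. -/
noncomputable def radialStretchJacobian {n : ℕ} (α : Fin n → ℝ) (x : EuclideanSpace ℝ (Fin n)) :
    Matrix (Fin n) (Fin n) ℝ :=
  diagonal (fun i => ‖x‖ ^ α i) *
    (1 + replicateCol Unit (fun i => α i * x i / ‖x‖ ^ 2) * replicateRow Unit x)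

open Matrix in
theorem toLpLin_radialStretchJacobian_apply {n : ℕ} (α : Fin n → ℝ)
    (x v : EuclideanSpace ℝ (Fin n)) (i : Fin n) :
    toLpLin 2 2 (radialStretchJacobian α x) v i =
      ‖x‖ ^ α i * (v i + α i * x i / ‖x‖ ^ 2 * inner ℝ x v) := by
  rw [toLpLin_apply, radialStretchJacobian, ← mulVec_mulVec, PiLp.toLp_apply, mulVec_diagonal,
    add_mulVec, one_mulVec]
  simp only [Pi.add_apply, mulVec, dotProduct, mul_apply, replicateCol_apply, replicateRow_apply,
    Finset.univ_unique, Finset.sum_singleton, PiLp.inner_apply, RCLike.inner_apply,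
    conj_trivial, Finset.mul_sum, mul_assoc, mul_comm (v _)]

theorem hasFDerivAt_norm_rpow_of_ne_zero {E : Type*} [NormedAddCommGroup E]
    [InnerProductSpace ℝ E] {x : E} (hx : x ≠ 0) (a : ℝ) :
    HasFDerivAt (fun y : E => ‖y‖ ^ a) ((a * ‖x‖ ^ (a - 2)) • innerSL ℝ x) x := by
  convert! (hasStrictFDerivAt_norm_sq x).hasFDerivAt.rpow_const (p := a / 2) (by simp [hx]) using 0
  have h (y : E) (b : ℝ) : (‖y‖ ^ 2) ^ b = ‖y‖ ^ (2 * b) := by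
    rw [← Real.rpow_natCast_mul (norm_nonneg _)]; simp
  simp_rw [h, ← Nat.cast_smul_eq_nsmul ℝ, smul_smul]
  ring_nf

open Matrix in
theorem hasFDerivAt_radialStretch {n : ℕ} (α : Fin n → ℝ) {x : EuclideanSpace ℝ (Fin n)}
    (hx : x ≠ 0) :
    HasFDerivAt (radialStretch n α)
      (LinearMap.toContinuousLinearMap (toLpLin 2 2 (radialStretchJacobian α x))) x := by
  have hx' : 0 < ‖x‖ := norm_pos_iff.2 hx
  rw [← hasFDerivWithinAt_univ, hasFDerivWithinAt_euclidean]
  intro i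
  rw [hasFDerivWithinAt_univ]
  convert! (EuclideanSpace.proj (𝕜 := ℝ) i).hasFDerivAt.mul
    (hasFDerivAt_norm_rpow_of_ne_zero hx (α i)) using 1
  ext v
  have h := toLpLin_radialStretchJacobian_apply α x v i
  simp only [ContinuousLinearMap.comp_apply, LinearMap.coe_toContinuousLinearMap',
    PiLp.proj_apply, _root_.add_apply, _root_.smul_apply, smul_eq_mul,
    innerSL_apply_apply, h, Real.rpow_sub hx', Real.rpow_two]
  ring

theorem det_radialStretchJacobian {n : ℕ} (α : Fin n → ℝ) {x : EuclideanSpace ℝ (Fin n)}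
    (hx : x ≠ 0) :
    (radialStretchJacobian α x).det =
      ‖x‖ ^ (∑ i, α i) * (1 + (∑ i, α i * x i ^ 2) / ‖x‖ ^ 2) := by
  rw [radialStretchJacobian, Matrix.det_mul, Matrix.det_diagonal,
    Matrix.det_one_add_replicateCol_mul_replicateRow,
    Real.rpow_sum_of_pos (norm_pos_iff.2 hx)]
  simp only [dotProduct, Finset.sum_div]
  congr 2
  exact Finset.sum_congr rfl fun i _ => by ring

theorem one_add_mul_rpow_le_det_radialStretchJacobian {n : ℕ} {α : Fin n → ℝ} {a : ℝ}
    (ha : ∀ i, a ≤ α i) {x : EuclideanSpace ℝ (Fin n)} (hx : x ≠ 0) :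
    ‖x‖ ^ (∑ i, α i) * (1 + a) ≤ (radialStretchJacobian α x).det := by
  have hx' : 0 < ‖x‖ := norm_pos_iff.2 hx
  rw [det_radialStretchJacobian α hx]
  gcongr
  rw [le_div_iff₀ (by positivity), EuclideanSpace.real_norm_sq_eq, Finset.mul_sum]
  gcongr with i
  exact ha i

theorem EuclideanSpace.norm_le_mul_norm_of_forall_abs_le {ι : Type*} [Fintype ι] {c : ℝ}
    (hc : 0 ≤ c) {y z : EuclideanSpace ℝ ι} (h : ∀ i, |y i| ≤ c * |z i|) : ‖y‖ ≤ c * ‖z‖ := by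
  refine le_of_sq_le_sq ?_ (by positivity)
  rw [mul_pow, EuclideanSpace.real_norm_sq_eq, EuclideanSpace.real_norm_sq_eq, Finset.mul_sum]
  refine Finset.sum_le_sum fun i _ => ?_
  rw [← sq_abs (y i), ← sq_abs (z i), ← mul_pow]
  exact pow_le_pow_left₀ (abs_nonneg _) (h i) 2

open Matrix in
theorem norm_toLpLin_radialStretchJacobian_le {n : ℕ} {α : Fin n → ℝ} {a A : ℝ}
    (ha : ∀ i, a ≤ α i) (hA : ∀ i, |α i| ≤ A) (hA0 : 0 ≤ A) {x : EuclideanSpace ℝ (Fin n)}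
    (hx : x ≠ 0) (hx1 : ‖x‖ ≤ 1) :
    ‖LinearMap.toContinuousLinearMap (toLpLin 2 2 (radialStretchJacobian α x))‖ ≤
      ‖x‖ ^ a * (1 + A) := by
  have hx' : 0 < ‖x‖ := norm_pos_iff.2 hx
  refine ContinuousLinearMap.opNorm_le_bound _ (by positivity) fun v => ?_
  let αx : EuclideanSpace ℝ (Fin n) := WithLp.toLp 2 fun i => α i * x i
  have hαx : ‖αx‖ ≤ A * ‖x‖ :=
    EuclideanSpace.norm_le_mul_norm_of_forall_abs_le hA0 fun i => by
      simp only [αx, abs_mul]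
      gcongr
      exact hA i
  let c : ℝ := inner ℝ x v / ‖x‖ ^ 2
  have hc : |c| * ‖αx‖ ≤ A * ‖v‖ := by
    calc |c| * ‖αx‖ ≤ ‖x‖ * ‖v‖ / ‖x‖ ^ 2 * (A * ‖x‖) := by
          simp only [c, abs_div, abs_of_pos (pow_pos hx' 2)]
          gcongr
          exact abs_real_inner_le_norm x v
      _ = A * ‖v‖ := by field_simp
  calc _ ≤ ‖x‖ ^ a * ‖v + c • αx‖ := by
        refine EuclideanSpace.norm_le_mul_norm_of_forall_abs_le (by positivity) fun i => ?_
        have h : v i + α i * x i / ‖x‖ ^ 2 * inner ℝ x v = (v + c • αx) i := by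
          simp only [c, αx, PiLp.add_apply, PiLp.smul_apply, smul_eq_mul]
          ring
        rw [LinearMap.coe_toContinuousLinearMap', toLpLin_radialStretchJacobian_apply, h, abs_mul,
          abs_of_pos (Real.rpow_pos_of_pos hx' _)]
        gcongr ?_ * _
        exact Real.rpow_le_rpow_of_exponent_ge hx' hx1 (ha i)
    _ ≤ ‖x‖ ^ a * (‖v‖ + A * ‖v‖) := by
        gcongr
        refine (norm_add_le _ _).trans ?_
        rw [norm_smul, Real.norm_eq_abs]
        gcongr
    _ = _ := by ring


/-- Let `n ≥ 2`, `−1 < α₁ ≤ ⋯ ≤ αₙ` with sum `α` and `A = maxᵢ|αᵢ|`, and let `p ≥ 1`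
satisfy `α₁ p ≥ α`. Then the generalized radial stretch `φ` is `p`-quasiconformal on the
punctured unit ball: for every `x` with `0 < |x| ≤ 1`,
`‖Dφ(x)‖^p / det Dφ(x) ≤ (1 + A)^p / (1 + α₁)`. -/
theorem radialStretch_p_quasiconformal (n : ℕ) (hn : 2 ≤ n) (α : Fin n → ℝ)
    (hmono : Monotone α) (h₁ : -1 < α ⟨0, by omega⟩)
    (A : ℝ) (hA : ∀ i, |α i| ≤ A) (hA' : ∃ i, |α i| = A)
    (p : ℝ) (hp : 1 ≤ p) (hpα : α ⟨0, by omega⟩ * p ≥ ∑ i, α i)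
    (x : EuclideanSpace ℝ (Fin n)) (hx0 : 0 < ‖x‖) (hx1 : ‖x‖ ≤ 1) :
    ‖fderiv ℝ (radialStretch n α) x‖ ^ p /
        LinearMap.det (fderiv ℝ (radialStretch n α) x).toLinearMap ≤
      (1 + A) ^ p / (1 + α ⟨0, by omega⟩) := by
  have hx : x ≠ 0 := norm_pos_iff.1 hx0
  have ha (i : Fin n) : α ⟨0, by omega⟩ ≤ α i := hmono (Fin.mk_le_of_le_val (Nat.zero_le _))
  obtain ⟨j, hj⟩ := hA'
  have hA0 : 0 ≤ A := hj ▸ abs_nonneg _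
  generalize α ⟨0, _⟩ = a at *
  have ha1 : 0 < 1 + a := by linarith
  rw [(hasFDerivAt_radialStretch α hx).fderiv, LinearMap.coe_toContinuousLinearMap,
    LinearMap.det_toLpLin]
  have hS : 0 < ‖x‖ ^ (∑ i, α i) := Real.rpow_pos_of_pos hx0 _
  have hdet := one_add_mul_rpow_le_det_radialStretchJacobian ha hx
  have hnorm : ‖LinearMap.toContinuousLinearMap
      (Matrix.toLpLin 2 2 (radialStretchJacobian α x))‖ ^ p ≤
        ‖x‖ ^ (∑ i, α i) * (1 + A) ^ p := by
    calc _ ≤ (‖x‖ ^ a * (1 + A)) ^ p := by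
          gcongr
          exact norm_toLpLin_radialStretchJacobian_le ha hA hA0 hx hx1
      _ = ‖x‖ ^ (a * p) * (1 + A) ^ p := by
          rw [Real.mul_rpow (by positivity) (by positivity), Real.rpow_mul hx0.le]
      _ ≤ _ := by
          gcongr ?_ * _
          exact Real.rpow_le_rpow_of_exponent_ge hx0 hx1 hpα
  calc _ ≤ ‖x‖ ^ (∑ i, α i) * (1 + A) ^ p / (‖x‖ ^ (∑ i, α i) * (1 + a)) := by gcongr
    _ = _ := mul_div_mul_left _ _ hS.ne'
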